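/- Let k be a field, n ≥ 2, A = k[x₁,…,xₙ], and R₂ = A/(x₂⋯xₙ). For i ≥ 1, the kernel of the canonical surjective A-linear map from Λ^i_A Ω_{A/k} to Ω^i_{R₂}/tors equals the A-submodule generated by the following two families of elements: (∏_{j ∈ {2,…,n}∖{a₁,…,a_{i-1}}} x_j)·dx₁∧dx_{a₁}∧⋯∧dx_{a_{i-1}} for all tuples 2 ≤ a₁ < ⋯ < a_{i-1} ≤ n, together with (∏_{j ∈ {2,…,n}∖{b₁,…,b_i}} x_j)·dx_{b₁}∧⋯∧dx_{b_i} for all tuples 2 ≤ b₁ < ⋯ < b_i ≤ n. Equivalently, Ω^i_{R₂}/tors ≅ Ω^i_A / ((⊕_{a} A·x_{a^c}·dx₁∧dx_a) ⊕ (⊕_{b} A·x_{b^c}·dx_b)). -/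

import Mathlib

set_option maxHeartbeats 1000000
set_option synthInstance.maxHeartbeats 400000

open ExteriorAlgebra MvPolynomial

noncomputable section

/-- `Ω^i_S`: the `i`-th exterior power (over `S`) of the module of Kähler differentials
of a `k`-algebra `S`. -/
abbrev OmegaPow (k : Type*) [CommRing k] (S : Type*) [CommRing S] [Algebra k S] (i : ℕ) :=
  ↥(⋀[S]^i (Ω[S⁄k]))

/-- The generator `s₀ • (d s₁ ∧ ⋯ ∧ d sᵢ)` of `Ω^i_S`. -/
def omegaGen (k : Type*) [CommRing k] (S : Type*) [CommRing S] [Algebra k S] (i : ℕ)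
    (s₀ : S) (v : Fin i → S) : OmegaPow k S i :=
  s₀ • ⟨ExteriorAlgebra.ιMulti S i (fun t => KaehlerDifferential.D k S (v t)),
    ExteriorAlgebra.ιMulti_range S i (Set.mem_range_self _)⟩

/-- `Ω^i_S / torsion`: the quotient of `Ω^i_S` by its torsion submodule (elements annihilated
by some nonzerodivisor). -/
abbrev OmegaPowModTors (k : Type*) [CommRing k] (S : Type*) [CommRing S] [Algebra k S]
    (i : ℕ) :=
  OmegaPow k S i ⧸ Submodule.torsion S (OmegaPow k S i)

/-- The class of the generator `s₀ • (d s₁ ∧ ⋯ ∧ d sᵢ)` in `Ω^i_S / torsion`. -/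
def omegaGenTors (k : Type*) [CommRing k] (S : Type*) [CommRing S] [Algebra k S] (i : ℕ)
    (s₀ : S) (v : Fin i → S) : OmegaPowModTors k S i :=
  Submodule.Quotient.mk (omegaGen k S i s₀ v)

/-- The polynomial ring `A = k[x₁, …, x_{n+2}]` (so that the number of variables is `≥ 2`). -/
abbrev polyA (k : Type*) [Field k] (n : ℕ) := MvPolynomial (Fin (n + 2)) k

/-- The ideal `(x₂ ⋯ x_{n+2})` of `A`. -/
abbrev idealR2 (k : Type*) [Field k] (n : ℕ) : Ideal (polyA k n) :=
  Ideal.span {∏ j ∈ Finset.univ.erase 0, X j}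

/-- `R₂ = A/(x₂ ⋯ x_{n+2})`, the coordinate ring of the union `E₁ᶜ` of the components of
the simple normal crossing divisor `E = {x₁⋯x_{n+2} = 0}` other than `E₁ = {x₁ = 0}`. -/
abbrev ringR2 (k : Type*) [Field k] (n : ℕ) := polyA k n ⧸ idealR2 k n

end

section OmegaPow

variable {k A R M : Type*} [CommRing k] [CommRing A] [CommRing R] [Algebra k A] [Algebra k R]
  [Algebra A R] [IsScalarTower k A R]

theorem omegaGen_eq_smul_ιMulti (i : ℕ) (s : R) (v : Fin i → R) :
    omegaGen k R i s v =
      s • exteriorPower.ιMulti R i (fun t => KaehlerDifferential.D k R (v t)) :=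
  rfl

variable (k A R) in
/-- The pullback `Ω^i_A → Ω^i_R` along the structure map `A → R`. -/
noncomputable def omegaPowMap (i : ℕ) : OmegaPow k A i →ₗ[A] OmegaPow k R i :=
  exteriorPower.alternatingMapLinearEquiv
    (AlternatingMap.compLinearMap
      { (exteriorPower.ιMulti R i (M := Ω[R⁄k])).toMultilinearMap.restrictScalars A with
        map_eq_zero_of_eq' := (exteriorPower.ιMulti R i (M := Ω[R⁄k])).map_eq_zero_of_eq' }
      (KaehlerDifferential.map k k A R))

theorem omegaPowMap_ιMulti (i : ℕ) (v : Fin i → Ω[A⁄k]) :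
    omegaPowMap k A R i (exteriorPower.ιMulti A i v) =
      exteriorPower.ιMulti R i (fun t => KaehlerDifferential.map k k A R (v t)) :=
  exteriorPower.alternatingMapLinearEquiv_apply_ιMulti _ _

theorem omegaPowMap_omegaGen (i : ℕ) (s : A) (v : Fin i → A) :
    omegaPowMap k A R i (omegaGen k A i s v) =
      omegaGen k R i (algebraMap A R s) (fun t => algebraMap A R (v t)) := by
  simp only [omegaGen_eq_smul_ιMulti, map_smul, omegaPowMap_ιMulti, KaehlerDifferential.map_D,
    algebraMap_smul]

theorem omegaPowMap_surjective (i : ℕ) (h : Function.Surjective (algebraMap A R)) :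
    Function.Surjective (omegaPowMap k A R i) := by
  intro w
  have hw : w ∈ Submodule.span R (Set.range (exteriorPower.ιMulti R i (M := Ω[R⁄k]))) := by
    rw [exteriorPower.ιMulti_span]; trivial
  induction hw using Submodule.span_induction with
  | mem x hx =>
    obtain ⟨v, rfl⟩ := hx
    choose u hu using fun t => KaehlerDifferential.map_surjective_of_surjective k k A R h (v t)
    exact ⟨exteriorPower.ιMulti A i u, by rw [omegaPowMap_ιMulti]; simp only [hu]⟩
  | zero => exact ⟨0, map_zero _⟩
  | add x y _ _ hx hy =>
    obtain ⟨x, rfl⟩ := hx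
    obtain ⟨y, rfl⟩ := hy
    exact ⟨x + y, map_add _ _ _⟩
  | smul r x _ hx =>
    obtain ⟨x, rfl⟩ := hx
    obtain ⟨a, rfl⟩ := h r
    exact ⟨a • x, by rw [map_smul, algebraMap_smul]⟩

/-- A derivation of `A` vanishing on the kernel of a surjection `A → R` descends to `R`. -/
noncomputable def Derivation.descend [AddCommGroup M] [Module k M] [Module A M] [Module R M]
    [IsScalarTower A R M] (h : Function.Surjective (algebraMap A R)) (d : Derivation k A M)
    (hd : ∀ a, algebraMap A R a = 0 → d a = 0) : Derivation k R M :=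
  have key (a b : A) (hab : algebraMap A R a = algebraMap A R b) : d a = d b := by
    rw [← sub_eq_zero, ← map_sub]
    exact hd _ (by rw [map_sub, hab, sub_self])
  Derivation.mk'
    { toFun := fun r => d (Function.surjInv h r)
      map_add' := fun x y => by
        rw [← map_add]
        exact key _ _ (by simp only [map_add, Function.surjInv_eq h])
      map_smul' := fun c x => by
        rw [RingHom.id_apply, ← map_smul]
        exact key _ _ (by
          rw [Function.surjInv_eq h, algebraMap.smul, Function.surjInv_eq h]) }
    fun x y => by
      change d _ = x • d _ + y • d _
      rw [key _ (Function.surjInv h x * Function.surjInv h y)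
        (by simp only [map_mul, Function.surjInv_eq h]), d.leibniz,
        ← algebraMap_smul R (Function.surjInv h x), ← algebraMap_smul R (Function.surjInv h y),
        Function.surjInv_eq h, Function.surjInv_eq h]

theorem Derivation.descend_algebraMap [AddCommGroup M] [Module k M] [Module A M] [Module R M]
    [IsScalarTower A R M] (h : Function.Surjective (algebraMap A R)) (d : Derivation k A M)
    (hd : ∀ a, algebraMap A R a = 0 → d a = 0) (a : A) :
    d.descend h hd (algebraMap A R a) = d a := by
  change d _ = d a
  rw [← sub_eq_zero, ← map_sub]
  exact hd _ (by rw [map_sub, Function.surjInv_eq h, sub_self])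

/-- The functional `r • ds₁ ∧ ⋯ ∧ dsᵢ ↦ r • det (d s_t)` attached to a derivation
`d : R → B^i`. -/
noncomputable def omegaPowDet {B : Type*} [CommRing B] [Algebra k B] [Algebra R B]
    [IsScalarTower k R B] {i : ℕ}
    (d : Derivation k R (Fin i → B)) : OmegaPow k R i →ₗ[R] B :=
  exteriorPower.alternatingMapLinearEquiv
    (AlternatingMap.compLinearMap
      { (Matrix.detRowAlternating (n := Fin i) (R := B)).toMultilinearMap.restrictScalars R with
        map_eq_zero_of_eq' :=
          (Matrix.detRowAlternating (n := Fin i) (R := B)).map_eq_zero_of_eq' }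
      d.liftKaehlerDifferential)

theorem omegaPowDet_omegaGen {B : Type*} [CommRing B] [Algebra k B] [Algebra R B]
    [IsScalarTower k R B] {i : ℕ}
    (d : Derivation k R (Fin i → B)) (s : R) (v : Fin i → R) :
    omegaPowDet d (omegaGen k R i s v) = s • Matrix.det (Matrix.of fun t => d (v t)) := by
  rw [omegaGen_eq_smul_ιMulti, map_smul]
  congr 1
  refine (exteriorPower.alternatingMapLinearEquiv_apply_ιMulti _ _).trans ?_
  change Matrix.det _ = _
  congr 1
  funext t
  exact d.liftKaehlerDifferential_comp_D (v t)

theorem omegaPowDet_eq_zero_of_mem_torsion {B : Type*} [CommRing B] [IsDomain B] [Algebra k B]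
    [Algebra R B] [IsScalarTower k R B] {i : ℕ}
    (hB : ∀ r ∈ nonZeroDivisors R, algebraMap R B r ≠ 0)
    (d : Derivation k R (Fin i → B)) (w : OmegaPow k R i)
    (hw : w ∈ Submodule.torsion R (OmegaPow k R i)) : omegaPowDet d w = 0 := by
  obtain ⟨r, hr⟩ := (Submodule.mem_torsion_iff _).1 hw
  have h : (r : R) • omegaPowDet d w = 0 := by
    rw [← map_smul]; exact (congrArg _ hr).trans (map_zero _)
  rw [Algebra.smul_def] at h
  exact (mul_eq_zero.1 h).resolve_left (hB r r.2)

end OmegaPow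

/-- Strictly monotone tuples are distinguished by the minors of the identity matrix. -/
theorem det_indicator_of_strictMono {B I : Type*} [CommRing B] [LinearOrder I] {i : ℕ}
    {b c : Fin i → I} (hb : StrictMono b) (hc : StrictMono c) :
    Matrix.det (Matrix.of fun t s => if b s = c t then (1 : B) else 0) =
      if b = c then 1 else 0 := by
  split_ifs with h
  · subst h
    rw [← Matrix.det_one (n := Fin i)]
    congr 1
    ext t s
    simp [Matrix.one_apply, hb.injective.eq_iff, eq_comm]
  · obtain ⟨t, ht⟩ : ∃ t, ∀ s, b s ≠ c t := by
      by_contra! H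
      refine h ((hb.range_inj hc).1 (Eq.symm (Set.eq_of_subset_of_ncard_le ?_ ?_ )))
      · rintro _ ⟨t, rfl⟩
        exact H t
      · rw [← Set.image_univ, ← Set.image_univ, Set.ncard_image_of_injective _ hb.injective,
          Set.ncard_image_of_injective _ hc.injective]
    exact Matrix.det_eq_zero_of_row_eq_zero t fun s => by simp [ht s]

/-- The Leibniz rule for a finite product. -/
theorem Derivation.map_finset_prod {k R M ι : Type*} [CommRing k] [CommRing R] [Algebra k R]
    [AddCommGroup M] [Module k M] [Module R M] [DecidableEq ι] (d : Derivation k R M)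
    (s : Finset ι) (x : ι → R) :
    d (∏ j ∈ s, x j) = ∑ l ∈ s, (∏ j ∈ s.erase l, x j) • d (x l) := by
  induction s using Finset.induction_on with
  | empty => simp
  | insert a s ha ih =>
    rw [Finset.prod_insert ha, d.leibniz, ih, Finset.sum_insert ha, Finset.erase_insert ha,
      Finset.smul_sum, add_comm]
    congr 1
    refine Finset.sum_congr rfl fun l hl => ?_
    have hal : a ≠ l := fun h => ha (h ▸ hl)
    rw [Finset.erase_insert_of_ne hal, Finset.prod_insert (fun h => ha (Finset.mem_of_mem_erase h)),
      mul_smul]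

/-- If `∏ j ∈ s, x j = 0`, then each partial product `∏ j ∈ s \ {m}, x j` annihilates
`(∏ j ∈ s \ b, x j) • dx_b`. -/
theorem prod_erase_smul_omegaGen_eq_zero {k R ι : Type*} [CommRing k] [CommRing R] [Algebra k R]
    [DecidableEq ι] {s : Finset ι} {x : ι → R} (hx : ∏ j ∈ s, x j = 0) {i : ℕ} (b : Fin i → ι)
    {m : ι} (hm : m ∈ s) :
    (∏ j ∈ s.erase m, x j) •
      omegaGen k R i (∏ j ∈ s \ Finset.image b Finset.univ, x j) (fun t => x (b t)) = 0 := by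
  have hcof (l : ι) (hl : l ∈ s) (hlb : ∀ t, b t ≠ l) :
      (∏ j ∈ s \ Finset.image b Finset.univ, x j) * ∏ j ∈ s.erase l, x j = 0 := by
    have hdvd : x l ∣ ∏ j ∈ s \ Finset.image b Finset.univ, x j :=
      Finset.dvd_prod_of_mem _ (by simp [hl, hlb])
    have h := mul_dvd_mul_right hdvd (∏ j ∈ s.erase l, x j)
    rwa [Finset.mul_prod_erase _ _ hl, hx, zero_dvd_iff] at h
  have hrel : ∑ l ∈ s, (∏ j ∈ s.erase l, x j) • KaehlerDifferential.D k R (x l) = 0 := by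
    rw [← Derivation.map_finset_prod, hx, map_zero]
  rw [omegaGen_eq_smul_ιMulti, smul_smul, mul_comm]
  by_cases hmb : ∃ t, b t = m
  swap
  · rw [hcof m hm (by simpa using hmb), zero_smul]
  obtain ⟨t, rfl⟩ := hmb
  set v : Fin i → Ω[R⁄k] := fun t => KaehlerDifferential.D k R (x (b t))
  rw [← Finset.add_sum_erase _ _ hm, add_eq_zero_iff_eq_neg] at hrel
  have hvt : (∏ j ∈ s.erase (b t), x j) • exteriorPower.ιMulti R i v =
      exteriorPower.ιMulti R i (Function.update v t ((∏ j ∈ s.erase (b t), x j) • v t)) := by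
    rw [AlternatingMap.map_update_smul, Function.update_eq_self]
  rw [mul_smul, hvt, hrel, AlternatingMap.map_update_neg, AlternatingMap.map_update_sum, smul_neg,
    Finset.smul_sum, neg_eq_zero]
  refine Finset.sum_eq_zero fun l hl => ?_
  rw [AlternatingMap.map_update_smul, smul_smul]
  by_cases hlb : ∃ u, b u = l
  · obtain ⟨u, rfl⟩ := hlb
    have hut : t ≠ u := fun h => Finset.ne_of_mem_erase hl (congrArg b h.symm)
    change _ • exteriorPower.ιMulti R i (Function.update v t (v u)) = 0
    rw [AlternatingMap.map_update_self _ _ hut, smul_zero]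
  · rw [hcof l (Finset.mem_of_mem_erase hl) (by simpa using hlb), zero_smul]


section Coordinates

variable {k : Type*} [Field k] {n : ℕ}

/-- The product of all the variables `x_j`, `j ∉ {0, m}`. -/
noncomputable abbrev cofactor (k : Type*) [Field k] (n : ℕ) (m : Fin (n + 2)) : polyA k n :=
  ∏ j ∈ (Finset.univ.erase 0).erase m, X j

theorem X_mul_cofactor {m : Fin (n + 2)} (hm : m ≠ 0) :
    X m * cofactor k n m = ∏ j ∈ Finset.univ.erase 0, X j :=
  Finset.mul_prod_erase _ _ (by simpa using hm)

theorem not_X_dvd_cofactor (m : Fin (n + 2)) : ¬ X m ∣ cofactor k n m := by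
  rw [Prime.dvd_finsetProd_iff (X_prime (i := m))]
  rintro ⟨j, hj, h⟩
  rw [X_dvd_X] at h
  exact Finset.ne_of_mem_erase hj h.symm

theorem X_dvd_cofactor {l m : Fin (n + 2)} (hm : m ≠ 0) (hlm : m ≠ l) :
    X m ∣ cofactor k n l :=
  Finset.dvd_prod_of_mem _ (by simp [hm, hlm])

theorem prod_X_dvd_of_forall {s : Finset (Fin (n + 2))} {g : polyA k n}
    (h : ∀ j ∈ s, X j ∣ g) : ∏ j ∈ s, X j ∣ g := by
  refine Finset.prod_dvd_of_isRelPrime (fun a _ b _ hab => ?_) h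
  refine ((X_prime (i := a)).irreducible.isRelPrime_iff_not_dvd).2 ?_
  rw [X_dvd_X]
  exact hab

theorem mk_eq_zero_iff_dvd {g : polyA k n} :
    Ideal.Quotient.mk (idealR2 k n) g = 0 ↔ ∏ j ∈ Finset.univ.erase 0, X j ∣ g := by
  rw [Ideal.Quotient.eq_zero_iff_mem, Ideal.mem_span_singleton]

theorem not_X_dvd_of_mk_mem_nonZeroDivisors {m : Fin (n + 2)} (hm : m ≠ 0) {g : polyA k n}
    (hg : Ideal.Quotient.mk (idealR2 k n) g ∈ nonZeroDivisors (ringR2 k n)) : ¬ X m ∣ g := by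
  rintro ⟨q, rfl⟩
  have h0 : Ideal.Quotient.mk (idealR2 k n) (cofactor k n m) = 0 := by
    refine (mem_nonZeroDivisors_iff.1 hg).1 _ ?_
    rw [← map_mul, mk_eq_zero_iff_dvd, ← X_mul_cofactor hm]
    exact ⟨q, by ring⟩
  rw [mk_eq_zero_iff_dvd, ← X_mul_cofactor hm] at h0
  exact not_X_dvd_cofactor m (dvd_of_mul_right_dvd h0)

theorem mk_sum_cofactor_mem_nonZeroDivisors :
    Ideal.Quotient.mk (idealR2 k n) (∑ m ∈ Finset.univ.erase 0, cofactor k n m) ∈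
      nonZeroDivisors (ringR2 k n) := by
  rw [mem_nonZeroDivisors_iff_right]
  intro x hx
  obtain ⟨g, rfl⟩ := Ideal.Quotient.mk_surjective x
  rw [← map_mul, mk_eq_zero_iff_dvd] at hx
  rw [mk_eq_zero_iff_dvd]
  refine prod_X_dvd_of_forall fun m hm => ?_
  have hm0 : m ≠ 0 := Finset.ne_of_mem_erase hm
  have h : X m ∣ g * ∑ m ∈ Finset.univ.erase 0, cofactor k n m :=
    (Finset.dvd_prod_of_mem _ hm).trans hx
  refine ((X_prime (i := m)).dvd_or_dvd h).resolve_right fun h' =>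
    not_X_dvd_cofactor (k := k) m ?_
  rw [← Finset.add_sum_erase _ _ hm] at h'
  refine (dvd_add_left (Finset.dvd_sum fun l hl => ?_)).1 h'
  exact X_dvd_cofactor hm0 (Finset.ne_of_mem_erase hl).symm

theorem omegaGen_mk_mem_torsion {i : ℕ} (b : Fin i → Fin (n + 2)) :
    omegaGen k (ringR2 k n) i
        (Ideal.Quotient.mk (idealR2 k n)
          (∏ j ∈ Finset.univ.erase 0 \ Finset.image b Finset.univ, X j))
        (fun t => Ideal.Quotient.mk (idealR2 k n) (X (b t))) ∈
      Submodule.torsion (ringR2 k n) (OmegaPow k (ringR2 k n) i) := by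
  have hx : ∏ j ∈ Finset.univ.erase 0, Ideal.Quotient.mk (idealR2 k n) (X j) = 0 := by
    rw [← map_prod, mk_eq_zero_iff_dvd]
  refine (Submodule.mem_torsion_iff _).2 ⟨⟨_, mk_sum_cofactor_mem_nonZeroDivisors⟩, ?_⟩
  rw [Submonoid.mk_smul, map_sum, map_prod]
  refine (Finset.sum_smul ..).trans (Finset.sum_eq_zero fun m hm => ?_)
  rw [map_prod]
  exact prod_erase_smul_omegaGen_eq_zero hx b hm

theorem exists_coordinate_functional {i : ℕ} {b : Fin i → Fin (n + 2)} (hb : StrictMono b)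
    {m : Fin (n + 2)} (hm : m ≠ 0) (hmb : ∀ t, b t ≠ m) :
    ∃ L : OmegaPow k (ringR2 k n) i →ₗ[polyA k n]
        polyA k n ⧸ Ideal.span {(X m : polyA k n)},
      (∀ w ∈ Submodule.torsion (ringR2 k n) (OmegaPow k (ringR2 k n) i), L w = 0) ∧
      ∀ (c : Fin i → Fin (n + 2)), StrictMono c →
        L (omegaGen k (ringR2 k n) i 1 fun t => Ideal.Quotient.mk (idealR2 k n) (X (c t))) =
          if b = c then 1 else 0 := by
  set J : Ideal (polyA k n) := Ideal.span {X m}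
  have hle : idealR2 k n ≤ J := by
    rw [Ideal.span_singleton_le_span_singleton]
    exact Finset.dvd_prod_of_mem _ (by simpa using hm)
  let : Algebra (ringR2 k n) (polyA k n ⧸ J) := (Ideal.Quotient.factor hle).toAlgebra
  have : IsScalarTower (polyA k n) (ringR2 k n) (polyA k n ⧸ J) :=
    ⟨fun a r y => by
      obtain ⟨r, rfl⟩ := Ideal.Quotient.mk_surjective r
      obtain ⟨y, rfl⟩ := Ideal.Quotient.mk_surjective y
      exact congrArg (Ideal.Quotient.mk J) (mul_assoc a r y)⟩
  have : IsScalarTower k (ringR2 k n) (polyA k n ⧸ J) :=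
    ⟨fun c r y => by
      obtain ⟨r, rfl⟩ := Ideal.Quotient.mk_surjective r
      obtain ⟨y, rfl⟩ := Ideal.Quotient.mk_surjective y
      exact congrArg (Ideal.Quotient.mk J) (smul_mul_assoc c r y)⟩
  have : J.IsPrime := (Ideal.span_singleton_prime (X_ne_zero m)).2 X_prime
  have hsurj : Function.Surjective (algebraMap (polyA k n) (ringR2 k n)) :=
    Ideal.Quotient.mk_surjective
  have hsmul (g : polyA k n) (hg : X m ∣ g) (y : Fin i → polyA k n ⧸ J) : g • y = 0 := by
    funext t
    obtain ⟨p, hp⟩ := Ideal.Quotient.mk_surjective (y t)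
    rw [Pi.smul_apply, ← hp]
    exact Ideal.Quotient.eq_zero_iff_mem.2
      (Ideal.mem_span_singleton.2 (dvd_mul_of_dvd_left hg p))
  let d₀ : Derivation k (polyA k n) (Fin i → polyA k n ⧸ J) :=
    mkDerivation k fun j t => if b t = j then 1 else 0
  have hd₀ (a : polyA k n) (ha : algebraMap (polyA k n) (ringR2 k n) a = 0) : d₀ a = 0 := by
    obtain ⟨q, rfl⟩ := mk_eq_zero_iff_dvd.1 ha
    have hf : d₀ (∏ j ∈ Finset.univ.erase 0, X j) = 0 := by
      rw [Derivation.map_finset_prod]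
      refine Finset.sum_eq_zero fun l _ => ?_
      by_cases hml : m = l
      · subst hml
        rw [show d₀ (X m) = 0 by
          rw [mkDerivation_X]; funext t; simp [hmb t], smul_zero]
      · exact hsmul _ (X_dvd_cofactor hm hml) _
    rw [Derivation.leibniz, hf, smul_zero, add_zero]
    exact hsmul _ (Finset.dvd_prod_of_mem _ (by simpa using hm)) _
  let d := d₀.descend hsurj hd₀
  refine ⟨(omegaPowDet d).restrictScalars (polyA k n), fun w hw => ?_, fun c hc => ?_⟩
  · refine omegaPowDet_eq_zero_of_mem_torsion (fun r hr h0 => ?_) d w hw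
    obtain ⟨g, rfl⟩ := Ideal.Quotient.mk_surjective r
    exact not_X_dvd_of_mk_mem_nonZeroDivisors hm hr
      (Ideal.mem_span_singleton.1 (Ideal.Quotient.eq_zero_iff_mem.1 h0))
  · rw [LinearMap.restrictScalars_apply, omegaPowDet_omegaGen,
      ← det_indicator_of_strictMono hb hc]
    refine (one_smul (ringR2 k n) (_ : polyA k n ⧸ J)).trans ?_
    congr 1
    funext t
    exact (d₀.descend_algebraMap hsurj hd₀ (X (c t))).trans (mkDerivation_X _ _ _)

/-- Every form on affine space is a combination of the `dx_b` with `b` strictly increasing. -/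
theorem exists_eq_sum_omegaGen (i : ℕ) (w : OmegaPow k (polyA k n) i) :
    ∃ c : (Fin i ↪o Fin (n + 2)) → polyA k n,
      w = ∑ b, c b • omegaGen k (polyA k n) i 1 (fun t => X (b t)) := by
  let B := (KaehlerDifferential.mvPolynomialBasis k (Fin (n + 2))).exteriorPower (n := i)
  refine ⟨fun b => B.repr w (Set.powersetCard.ofFinEmbEquiv b), ?_⟩
  conv_lhs => rw [← B.sum_repr w]
  rw [← Set.powersetCard.ofFinEmbEquiv.sum_comp]
  refine Finset.sum_congr rfl fun b _ => ?_
  congr 1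
  rw [exteriorPower.basis_apply, exteriorPower.ιMulti_family, omegaGen_eq_smul_ιMulti, one_smul,
    Equiv.symm_apply_apply]
  congr 1
  funext t
  simp

end Coordinates

/-- **Presentation (3) of the appendix.**  For `i ≥ 1`, the kernel of the canonical
surjective (`A`-linear) map `Ω^i_A → Ω^i_{R₂}/tors` equals the `A`-submodule of
`Ω^i_A = ⋀^i_A Ω_{A/k}` generated by the two families of elements
`(∏_{j ∈ {2,…,n}∖{a₁,…,a_{i-1}}} x_j) · dx₁ ∧ dx_{a₁} ∧ ⋯ ∧ dx_{a_{i-1}}`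
(for strictly increasing tuples with entries in `{2,…,n}`, encoded as strictly monotone
`a : Fin i → Fin (n+2)` with `a 0 = 0`) together with
`(∏_{j ∈ {2,…,n}∖{b₁,…,b_i}} x_j) · dx_{b₁} ∧ ⋯ ∧ dx_{b_i}`
(for strictly monotone `b : Fin i → Fin (n+2)` avoiding the index `0`); equivalently,
`Ω^i_{R₂}/tors ≅ Ω^i_A / ((⊕_a A·x_{aᶜ}·dx₁∧dx_a) ⊕ (⊕_b A·x_{bᶜ}·dx_b))`.
The canonical map `φ` is pinned down by its values on the generators
`a₀ • (d a₁ ∧ ⋯ ∧ d a_i)`, which generate `Ω^i_A`. -/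
theorem stmt8 (k : Type*) [Field k] (n i : ℕ) (hi : 1 ≤ i) :
    ∃ φ : OmegaPow k (polyA k n) i →+ OmegaPowModTors k (ringR2 k n) i,
      (∀ (a₀ : polyA k n) (v : Fin i → polyA k n),
        φ (omegaGen k (polyA k n) i a₀ v)
          = omegaGenTors k (ringR2 k n) i (Ideal.Quotient.mk (idealR2 k n) a₀)
              fun t => Ideal.Quotient.mk (idealR2 k n) (v t)) ∧
      Function.Surjective φ ∧
      (∀ w : OmegaPow k (polyA k n) i,
        φ w = 0 ↔
          w ∈ Submodule.span (polyA k n)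
            {w : OmegaPow k (polyA k n) i |
              (∃ a : Fin i → Fin (n + 2), StrictMono a ∧ a ⟨0, hi⟩ = 0 ∧
                w = omegaGen k (polyA k n) i
                      (∏ j ∈ Finset.univ.erase 0 \ Finset.image a Finset.univ, X j)
                      (fun t => X (a t))) ∨
              (∃ b : Fin i → Fin (n + 2), StrictMono b ∧ (∀ t, b t ≠ 0) ∧
                w = omegaGen k (polyA k n) i
                      (∏ j ∈ Finset.univ.erase 0 \ Finset.image b Finset.univ, X j)
                      (fun t => X (b t)))}) := by
  let Q := Submodule.torsion (ringR2 k n) (OmegaPow k (ringR2 k n) i)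
  let ψ := omegaPowMap k (polyA k n) (ringR2 k n) i
  have hψ (b : Fin i → Fin (n + 2)) (s : polyA k n) :
      ψ (omegaGen k (polyA k n) i s fun t => X (b t)) =
        omegaGen k (ringR2 k n) i (Ideal.Quotient.mk (idealR2 k n) s)
          fun t => Ideal.Quotient.mk (idealR2 k n) (X (b t)) :=
    omegaPowMap_omegaGen _ _ _
  refine ⟨Q.mkQ.toAddMonoidHom.comp ψ.toAddMonoidHom, fun a₀ v => ?_, ?_, fun w => ?_⟩
  · exact congrArg Q.mkQ (omegaPowMap_omegaGen i a₀ v)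
  · exact Q.mkQ_surjective.comp (omegaPowMap_surjective i Ideal.Quotient.mk_surjective)
  change Q.mkQ (ψ w) = 0 ↔ _
  rw [Submodule.mkQ_apply, Submodule.Quotient.mk_eq_zero]
  constructor
  · intro hw
    obtain ⟨c, rfl⟩ := exists_eq_sum_omegaGen i w
    refine Submodule.sum_mem _ fun b _ => ?_
    have hdvd : ∏ j ∈ Finset.univ.erase 0 \ Finset.image b Finset.univ, X j ∣ c b := by
      refine prod_X_dvd_of_forall fun m hm => ?_
      simp only [Finset.mem_sdiff, Finset.mem_erase, Finset.mem_univ, and_true, Finset.mem_image,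
        true_and, not_exists] at hm
      obtain ⟨L, hL, hLc⟩ := exists_coordinate_functional (k := k) b.strictMono hm.1 hm.2
      have h := hL _ hw
      rw [map_sum, map_sum, Finset.sum_eq_single b] at h
      · rw [map_smul, map_smul, hψ, map_one, hLc _ b.strictMono, if_pos rfl,
          ← Algebra.algebraMap_eq_smul_one] at h
        exact Ideal.mem_span_singleton.1 (Ideal.Quotient.eq_zero_iff_mem.1 h)
      · intro b' _ hb'
        rw [map_smul, map_smul, hψ, map_one, hLc _ b'.strictMono,
          if_neg fun h => hb' (DFunLike.coe_injective h.symm), smul_zero]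
      · simp
    obtain ⟨q, hq⟩ := hdvd
    have hgen : c b • omegaGen k (polyA k n) i 1 (fun t => X (b t)) =
        q • omegaGen k (polyA k n) i
          (∏ j ∈ Finset.univ.erase 0 \ Finset.image b Finset.univ, X j) (fun t => X (b t)) := by
      simp only [omegaGen_eq_smul_ιMulti, one_smul, smul_smul, hq, mul_comm]
    rw [hgen]
    refine Submodule.smul_mem _ _ (Submodule.subset_span ?_)
    by_cases h0 : b ⟨0, hi⟩ = 0
    · exact Or.inl ⟨b, b.strictMono, h0, rfl⟩
    · refine Or.inr ⟨b, b.strictMono, fun t ht => h0 ?_, rfl⟩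
      exact Fin.le_zero_iff.1 (ht ▸ b.monotone (Fin.mk_le_of_le_val (Nat.zero_le _)))
  · intro hw
    suffices h : Submodule.span (polyA k n) _ ≤ (Q.restrictScalars (polyA k n)).comap ψ from h hw
    refine Submodule.span_le.2 ?_
    rintro _ (⟨b, -, -, rfl⟩ | ⟨b, -, -, rfl⟩) <;>
    · change ψ _ ∈ Q
      rw [hψ]
      exact omegaGen_mk_mem_torsion b
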